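/- Let A be a fanning frame and {A,t} its Schwarzian. (1) If X : ℝ → Matrix (Fin n) (Fin n) ℝ is smooth with X(t) invertible for every t, then the frame t ↦ A(t)X(t) is fanning and its Schwarzian is X(t)⁻¹{A,t}X(t). (2) If T is an invertible (kn)×(kn) real matrix, then the frame t ↦ T·A(t) is fanning and its Schwarzian equals {A,t}. -/

import Mathlib

open Matrix

noncomputable def mderiv {M N : ℕ} (A : ℝ → Matrix (Fin M) (Fin N) ℝ) :
    ℝ → Matrix (Fin M) (Fin N) ℝ :=
  fun t => Matrix.of fun i j => deriv (fun s => A s i j) t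

noncomputable def dmat {M N : ℕ} (i : ℕ) (A : ℝ → Matrix (Fin M) (Fin N) ℝ) :
    ℝ → Matrix (Fin M) (Fin N) ℝ :=
  mderiv^[i] A

def MatSmooth {M N : ℕ} (A : ℝ → Matrix (Fin M) (Fin N) ℝ) : Prop :=
  ∀ i j, ContDiff ℝ (⊤ : ℕ∞) fun t => A t i j

def juxt (k n : ℕ) (B : Fin k → Matrix (Fin (k * n)) (Fin n) ℝ) :
    Matrix (Fin (k * n)) (Fin (k * n)) ℝ :=
  Matrix.of fun r c => B (finProdFinEquiv.symm c).1 r (finProdFinEquiv.symm c).2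

noncomputable def frameMat (k n : ℕ) (A : ℝ → Matrix (Fin (k * n)) (Fin n) ℝ) (t : ℝ) :
    Matrix (Fin (k * n)) (Fin (k * n)) ℝ :=
  juxt k n fun i => dmat (i : ℕ) A t

def IsFanning (k n : ℕ) (A : ℝ → Matrix (Fin (k * n)) (Fin n) ℝ) : Prop :=
  MatSmooth A ∧ ∀ t, IsUnit (frameMat k n A t)

def IsCoeffs (k n : ℕ) (A : ℝ → Matrix (Fin (k * n)) (Fin n) ℝ)
    (P : ℕ → ℝ → Matrix (Fin n) (Fin n) ℝ) : Prop :=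
  (∀ i ∈ Finset.Icc 1 k, MatSmooth (P i)) ∧
  ∀ t, dmat k A t + ∑ i ∈ Finset.Icc 1 k, (k.choose i : ℝ) • (dmat (k - i) A t * P i t) = 0

theorem mderiv_mul {M N L : ℕ} {A : ℝ → Matrix (Fin M) (Fin N) ℝ}
    {X : ℝ → Matrix (Fin N) (Fin L) ℝ} (hA : MatSmooth A) (hX : MatSmooth X) (t : ℝ) :
    mderiv (fun t => A t * X t) t = mderiv A t * X t + A t * mderiv X t := by
  have dA (i j) : DifferentiableAt ℝ (fun s => A s i j) t :=
    (hA i j).differentiable (by simp) t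
  have dX (i j) : DifferentiableAt ℝ (fun s => X s i j) t :=
    (hX i j).differentiable (by simp) t
  ext i j
  simp only [mderiv, Matrix.of_apply, Matrix.mul_apply, Matrix.add_apply]
  rw [deriv_fun_sum fun p _ => (dA i p).fun_mul (dX p j), ← Finset.sum_add_distrib]
  exact Finset.sum_congr rfl fun p _ => deriv_fun_mul (dA i p) (dX p j)

theorem mderiv_add {M N : ℕ} {A B : ℝ → Matrix (Fin M) (Fin N) ℝ}
    (hA : MatSmooth A) (hB : MatSmooth B) (t : ℝ) :
    mderiv (fun t => A t + B t) t = mderiv A t + mderiv B t := by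
  ext i j
  exact deriv_fun_add ((hA i j).differentiable (by simp) t) ((hB i j).differentiable (by simp) t)

theorem MatSmooth.mderiv {M N : ℕ} {A : ℝ → Matrix (Fin M) (Fin N) ℝ} (hA : MatSmooth A) :
    MatSmooth (mderiv A) :=
  fun i j => (contDiff_infty_iff_deriv.1 (hA i j)).2

theorem dmat_succ {M N : ℕ} (m : ℕ) (A : ℝ → Matrix (Fin M) (Fin N) ℝ) :
    dmat (m + 1) A = mderiv (dmat m A) :=
  Function.iterate_succ_apply' _ _ _

theorem dmat_apply {M N : ℕ} (m : ℕ) (A : ℝ → Matrix (Fin M) (Fin N) ℝ) (t : ℝ)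
    (i : Fin M) (j : Fin N) : dmat m A t i j = iteratedDeriv m (fun s => A s i j) t := by
  induction m generalizing t with
  | zero => simp [dmat]
  | succ m ih => simp [dmat_succ, iteratedDeriv_succ, mderiv, ih]

theorem MatSmooth.mul {M N L : ℕ} {A : ℝ → Matrix (Fin M) (Fin N) ℝ}
    {X : ℝ → Matrix (Fin N) (Fin L) ℝ} (hA : MatSmooth A) (hX : MatSmooth X) :
    MatSmooth fun t => A t * X t := by
  intro i j
  simp only [Matrix.mul_apply]
  exact ContDiff.sum fun p _ => (hA i p).mul (hX p j)

theorem MatSmooth.const {M N : ℕ} (T : Matrix (Fin M) (Fin N) ℝ) : MatSmooth fun _ => T :=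
  fun _ _ => contDiff_const

theorem MatSmooth.det {N : ℕ} {X : ℝ → Matrix (Fin N) (Fin N) ℝ} (hX : MatSmooth X) :
    ContDiff ℝ (⊤ : ℕ∞) fun t => (X t).det := by
  simp only [Matrix.det_apply]
  exact ContDiff.sum fun σ _ => (contDiff_prod fun i _ => hX _ _).const_smul _

theorem MatSmooth.inv {N : ℕ} {X : ℝ → Matrix (Fin N) (Fin N) ℝ} (hX : MatSmooth X)
    (hu : ∀ t, IsUnit (X t)) : MatSmooth fun t => (X t)⁻¹ := by
  intro i j
  simp only [Matrix.inv_def, Ring.inverse_eq_inv', Matrix.smul_apply, smul_eq_mul,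
    Matrix.adjugate_apply]
  refine (hX.det.inv fun t => ((Matrix.isUnit_iff_isUnit_det _).1 (hu t)).ne_zero).mul
    (MatSmooth.det fun p q => ?_)
  simp only [Matrix.updateRow_apply]
  split_ifs
  · exact contDiff_const
  · exact hX p q

/-- The Leibniz rule for matrix products. -/
theorem dmat_mul {M N L : ℕ} {A : ℝ → Matrix (Fin M) (Fin N) ℝ}
    {X : ℝ → Matrix (Fin N) (Fin L) ℝ} (hA : MatSmooth A) (hX : MatSmooth X) (m : ℕ) (t : ℝ) :
    dmat m (fun t => A t * X t) t =
      ∑ j ∈ Finset.range (m + 1), (m.choose j : ℝ) • (dmat j A t * dmat (m - j) X t) := by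
  have cA (i j) : ContDiffAt ℝ m (fun s => A s i j) t :=
    ((hA i j).of_le (by exact_mod_cast le_top)).contDiffAt
  have cX (i j) : ContDiffAt ℝ m (fun s => X s i j) t :=
    ((hX i j).of_le (by exact_mod_cast le_top)).contDiffAt
  ext r c
  simp only [dmat_apply, Matrix.mul_apply, Matrix.sum_apply, Matrix.smul_apply, smul_eq_mul,
    Finset.mul_sum]
  rw [iteratedDeriv_fun_sum fun p _ => (cA r p).mul (cX p c), Finset.sum_comm]
  refine Finset.sum_congr rfl fun p _ => ?_
  rw [iteratedDeriv_fun_mul (cA r p) (cX p c)]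
  simp only [mul_assoc]

theorem dmat_const_mul {M N L : ℕ} (T : Matrix (Fin M) (Fin N) ℝ)
    {A : ℝ → Matrix (Fin N) (Fin L) ℝ} (hA : MatSmooth A) (m : ℕ) (t : ℝ) :
    dmat m (fun t => T * A t) t = T * dmat m A t := by
  rw [dmat_mul (MatSmooth.const T) hA, Finset.sum_range_succ', Finset.sum_eq_zero]
  · simp [dmat]
  · intro j _
    have : dmat (j + 1) (fun _ : ℝ => T) t = 0 := by
      ext r c
      simp [dmat_apply, iteratedDeriv_const]
    simp [this]

theorem juxt_mul_of {k n L : ℕ} (B : Fin k → Matrix (Fin (k * n)) (Fin n) ℝ)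
    (C : Fin k → Matrix (Fin n) (Fin L) ℝ) :
    juxt k n B * Matrix.of (fun r c => C (finProdFinEquiv.symm r).1 (finProdFinEquiv.symm r).2 c) =
      ∑ j, B j * C j := by
  ext r c
  simp only [juxt, Matrix.mul_apply, Matrix.sum_apply, Matrix.of_apply]
  rw [← finProdFinEquiv.sum_comp, Fintype.sum_prod_type]
  simp

theorem eq_zero_of_sum_dmat_mul_eq_zero {k n L : ℕ} {A : ℝ → Matrix (Fin (k * n)) (Fin n) ℝ}
    (hA : IsFanning k n A) {t : ℝ} {C : ℕ → Matrix (Fin n) (Fin L) ℝ}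
    (h : ∑ j ∈ Finset.range k, dmat j A t * C j = 0) {j : ℕ} (hj : j < k) : C j = 0 := by
  have h₁ := juxt_mul_of (fun i : Fin k => dmat (i : ℕ) A t) (fun i : Fin k => C i)
  rw [Fin.sum_univ_eq_sum_range (fun j => dmat j A t * C j) k, h] at h₁
  obtain ⟨u, hu⟩ := (hA.2 t).exists_left_inv
  have h₂ := congrArg (u * ·) h₁
  change u * (frameMat k n A t * _) = u * 0 at h₂
  rw [← Matrix.mul_assoc, hu, Matrix.one_mul, Matrix.mul_zero] at h₂
  ext p q
  simpa only [Matrix.of_apply, Equiv.symm_apply_apply, Matrix.zero_apply] using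
    congrFun (congrFun h₂ (finProdFinEquiv (⟨j, hj⟩, p))) q

theorem IsFanning.of_mul_right {k n : ℕ} {B : ℝ → Matrix (Fin (k * n)) (Fin n) ℝ}
    {Y : ℝ → Matrix (Fin n) (Fin n) ℝ} (hB : MatSmooth B) (hY : MatSmooth Y)
    (h : IsFanning k n fun t => B t * Y t) : IsFanning k n B := by
  refine ⟨hB, fun t => ?_⟩
  have key : frameMat k n (fun t => B t * Y t) t = frameMat k n B t *
      Matrix.of (fun r c => (((finProdFinEquiv.symm c).1 : ℕ).choose (finProdFinEquiv.symm r).1 : ℝ) *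
        dmat ((finProdFinEquiv.symm c).1 - (finProdFinEquiv.symm r).1 : ℕ) Y t
          (finProdFinEquiv.symm r).2 (finProdFinEquiv.symm c).2) := by
    ext r c
    obtain ⟨⟨i, q⟩, rfl⟩ := finProdFinEquiv.surjective c
    simp only [frameMat, juxt, Matrix.mul_apply, Matrix.of_apply, Equiv.symm_apply_apply]
    rw [← finProdFinEquiv.sum_comp, Fintype.sum_prod_type, dmat_mul hB hY]
    simp only [Equiv.symm_apply_apply]
    rw [Fin.sum_univ_eq_sum_range (fun j => ∑ p, dmat j B t r p *
      (((i : ℕ).choose j : ℝ) * dmat ((i : ℕ) - j) Y t p q)) k,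
      ← Finset.sum_subset (Finset.range_mono (Nat.succ_le_of_lt i.2))]
    · simp only [Matrix.sum_apply, Matrix.smul_apply, Matrix.mul_apply, smul_eq_mul, Finset.mul_sum]
      exact Finset.sum_congr rfl fun j _ => Finset.sum_congr rfl fun p _ => by ring
    · intro j _ hj
      have : (i : ℕ).choose j = 0 := Nat.choose_eq_zero_of_lt (by simpa using hj)
      simp [this]
  exact isUnit_of_mul_isUnit_left (key ▸ h.2 t)

theorem IsFanning.mul_right {k n : ℕ} {A : ℝ → Matrix (Fin (k * n)) (Fin n) ℝ}
    (hA : IsFanning k n A) {X : ℝ → Matrix (Fin n) (Fin n) ℝ} (hX : MatSmooth X)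
    (hu : ∀ t, IsUnit (X t)) : IsFanning k n fun t => A t * X t := by
  refine .of_mul_right (hA.1.mul hX) (hX.inv hu) ?_
  have (t : ℝ) : A t * X t * (X t)⁻¹ = A t :=
    Matrix.mul_nonsing_inv_cancel_right _ _ ((Matrix.isUnit_iff_isUnit_det _).1 (hu t))
  simpa only [this] using hA

theorem IsFanning.const_mul {k n : ℕ} {A : ℝ → Matrix (Fin (k * n)) (Fin n) ℝ}
    (hA : IsFanning k n A) {T : Matrix (Fin (k * n)) (Fin (k * n)) ℝ} (hT : IsUnit T) :
    IsFanning k n fun t => T * A t := by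
  refine ⟨(MatSmooth.const T).mul hA.1, fun t => ?_⟩
  have : frameMat k n (fun t => T * A t) t = T * frameMat k n A t := by
    ext r c
    simp [frameMat, juxt, dmat_const_mul T hA.1, Matrix.mul_apply]
  exact this ▸ hT.mul (hA.2 t)

theorem IsCoeffs.sum_range {k n : ℕ} {A : ℝ → Matrix (Fin (k * n)) (Fin n) ℝ}
    {P : ℕ → ℝ → Matrix (Fin n) (Fin n) ℝ} (hP : IsCoeffs k n A P) (t : ℝ) :
    dmat k A t + ∑ j ∈ Finset.range k, (k.choose j : ℝ) • (dmat j A t * P (k - j) t) = 0 := by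
  rw [← hP.2 t]
  congr 1
  refine Finset.sum_nbij' (k - ·) (k - ·) ?_ ?_ ?_ ?_ ?_ <;>
    simp only [Finset.mem_range, Finset.mem_Icc]
  · omega
  · omega
  · omega
  · omega
  · intro j hj
    rw [Nat.choose_symm hj.le, Nat.sub_sub_self hj.le]

/-- Any linear relation among `A, …, A^{(k)}` is a multiple of the defining relation of `P`. -/
theorem IsCoeffs.eq_of_sum_eq_zero {k n : ℕ} {A : ℝ → Matrix (Fin (k * n)) (Fin n) ℝ}
    (hA : IsFanning k n A) {P : ℕ → ℝ → Matrix (Fin n) (Fin n) ℝ} (hP : IsCoeffs k n A P)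
    {t : ℝ} {D : ℕ → Matrix (Fin n) (Fin n) ℝ}
    (h : dmat k A t * D k + ∑ j ∈ Finset.range k, dmat j A t * D j = 0) {j : ℕ} (hj : j < k) :
    D j = (k.choose j : ℝ) • (P (k - j) t * D k) := by
  rw [eq_neg_of_add_eq_zero_left (hP.sum_range t), Matrix.neg_mul, neg_add_eq_zero,
    Matrix.sum_mul, eq_comm, ← sub_eq_zero, ← Finset.sum_sub_distrib] at h
  refine sub_eq_zero.1 (eq_zero_of_sum_dmat_mul_eq_zero hA (t := t)
    (C := fun j => D j - (k.choose j : ℝ) • (P (k - j) t * D k)) ?_ hj)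
  rw [← h]
  refine Finset.sum_congr rfl fun j _ => ?_
  rw [Matrix.mul_sub, Matrix.mul_smul, Matrix.smul_mul, Matrix.mul_assoc]

theorem IsCoeffs.unique {k n : ℕ} {A : ℝ → Matrix (Fin (k * n)) (Fin n) ℝ}
    (hA : IsFanning k n A) {P Q : ℕ → ℝ → Matrix (Fin n) (Fin n) ℝ} (hP : IsCoeffs k n A P)
    (hQ : IsCoeffs k n A Q) {i : ℕ} (hi : 1 ≤ i) (hik : i ≤ k) : Q i = P i := by
  funext t
  have h := IsCoeffs.eq_of_sum_eq_zero hA hP (t := t)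
    (D := fun j => if j < k then (k.choose j : ℝ) • Q (k - j) t else 1) ?_
    (show k - i < k by omega)
  · have hc : (k.choose (k - i) : ℝ) ≠ 0 := by
      exact_mod_cast (Nat.choose_pos (Nat.sub_le k i)).ne'
    simpa [show k - i < k by omega, Nat.sub_sub_self hik, hc] using h
  · rw [← hQ.sum_range t]
    simp only [lt_irrefl, if_false, Matrix.mul_one]
    congr 1
    refine Finset.sum_congr rfl fun j hj => ?_
    rw [if_pos (Finset.mem_range.1 hj), Matrix.mul_smul]

theorem IsCoeffs.of_const_mul {k n : ℕ} {A : ℝ → Matrix (Fin (k * n)) (Fin n) ℝ}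
    (hA : MatSmooth A) {T : Matrix (Fin (k * n)) (Fin (k * n)) ℝ} (hT : IsUnit T)
    {Q : ℕ → ℝ → Matrix (Fin n) (Fin n) ℝ} (hQ : IsCoeffs k n (fun t => T * A t) Q) :
    IsCoeffs k n A Q := by
  refine ⟨hQ.1, fun t => ?_⟩
  have h := hQ.2 t
  simp only [dmat_const_mul T hA, Matrix.mul_assoc, ← Matrix.mul_smul] at h
  rw [← Matrix.mul_sum, ← Matrix.mul_add] at h
  obtain ⟨u, hu⟩ := hT.exists_left_inv
  simpa [← Matrix.mul_assoc, hu] using congrArg (u * ·) h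

theorem IsCoeffs.sum_leibniz {k n : ℕ} {A : ℝ → Matrix (Fin (k * n)) (Fin n) ℝ}
    (hA : MatSmooth A) {X : ℝ → Matrix (Fin n) (Fin n) ℝ} (hX : MatSmooth X)
    {Q : ℕ → ℝ → Matrix (Fin n) (Fin n) ℝ} (hQ : IsCoeffs k n (fun t => A t * X t) Q) (t : ℝ) :
    ∑ j ∈ Finset.range (k + 1), dmat j A t * ((k.choose j : ℝ) • dmat (k - j) X t +
      ∑ m ∈ Finset.range k, ((k.choose m : ℝ) * (m.choose j : ℝ)) •
        (dmat (m - j) X t * Q (k - m) t)) = 0 := by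
  rw [← hQ.sum_range t, dmat_mul hA hX]
  simp only [Matrix.mul_add, Finset.sum_add_distrib, Matrix.mul_smul, Matrix.mul_sum]
  congr 1
  rw [Finset.sum_comm]
  refine Finset.sum_congr rfl fun m hm => ?_
  rw [dmat_mul hA hX, Matrix.sum_mul, Finset.smul_sum]
  symm
  refine Finset.sum_subset_zero_on_sdiff (Finset.range_mono ?_) ?_ ?_
  · have := Finset.mem_range.1 hm
    omega
  · intro j hj
    have : m.choose j = 0 := Nat.choose_eq_zero_of_lt (by simpa using (Finset.mem_sdiff.1 hj).2)
    simp [this]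
  · intro j _
    rw [Matrix.smul_mul, smul_smul, Matrix.mul_assoc]

theorem IsCoeffs.mul_right_transform {k n : ℕ} (hk : 2 ≤ k)
    {A : ℝ → Matrix (Fin (k * n)) (Fin n) ℝ} (hA : IsFanning k n A)
    {P : ℕ → ℝ → Matrix (Fin n) (Fin n) ℝ} (hP : IsCoeffs k n A P)
    {X : ℝ → Matrix (Fin n) (Fin n) ℝ} (hX : MatSmooth X)
    {Q : ℕ → ℝ → Matrix (Fin n) (Fin n) ℝ} (hQ : IsCoeffs k n (fun t => A t * X t) Q) (t : ℝ) :
    mderiv X t + X t * Q 1 t = P 1 t * X t ∧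
      mderiv (mderiv X) t + (2 : ℝ) • (mderiv X t * Q 1 t) + X t * Q 2 t = P 2 t * X t := by
  have h := hQ.sum_leibniz hA.1 hX t
  rw [Finset.sum_range_succ, add_comm] at h
  have key {j : ℕ} (hj : j < k) := hP.eq_of_sum_eq_zero hA
    (D := fun j => (k.choose j : ℝ) • dmat (k - j) X t +
      ∑ m ∈ Finset.range k, ((k.choose m : ℝ) * (m.choose j : ℝ)) •
        (dmat (m - j) X t * Q (k - m) t)) h hj
  have hlead : ∑ m ∈ Finset.range k, ((k.choose m : ℝ) * (m.choose k : ℝ)) •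
      (dmat (m - k) X t * Q (k - m) t) = 0 := Finset.sum_eq_zero fun m hm => by
    simp [Nat.choose_eq_zero_of_lt (Finset.mem_range.1 hm)]
  simp only [hlead, Nat.choose_self, Nat.cast_one, one_smul, Nat.sub_self, add_zero] at key
  obtain ⟨l, rfl⟩ := Nat.exists_eq_add_of_le' hk
  have hlow (j : ℕ) (hj : l ≤ j) : ∑ m ∈ Finset.range l, (((l + 2).choose m : ℝ) *
      (m.choose j : ℝ)) • (dmat (m - j) X t * Q (l + 2 - m) t) = 0 :=
    Finset.sum_eq_zero fun m hm => by
      simp [Nat.choose_eq_zero_of_lt ((Finset.mem_range.1 hm).trans_le hj)]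
  have d0 : dmat 0 X t = X t := rfl
  have d1 : dmat 1 X t = mderiv X t := rfl
  have d2 : dmat 2 X t = mderiv (mderiv X) t := rfl
  have e1 : l + 2 - (l + 1) = 1 := by omega
  have e2 : l + 1 - l = 1 := by omega
  have e3 : l + 2 - l = 2 := by omega
  have c1 : ((l + 2).choose (l + 1) : ℝ) = l + 2 := by
    rw [Nat.choose_succ_self_right]; push_cast; ring
  have c2 : ((l + 1).choose l : ℝ) = l + 1 := by
    rw [Nat.choose_succ_self_right]; push_cast; ring
  have c3 : ((l + 2).choose l : ℝ) = (l + 2) * (l + 1) / 2 := by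
    rw [Nat.choose_symm_add, Nat.cast_choose_two]; push_cast; ring
  have k1 := key (j := l + 1) (by omega)
  have k2 := key (j := l) (by omega)
  rw [Finset.sum_range_succ, Finset.sum_range_succ, hlow _ (by omega)] at k1 k2
  simp only [e1, e2, e3, c1, c2, c3, d0, d1, d2, Nat.sub_self, Nat.choose_self, Nat.choose_succ_self,
    Nat.cast_one, Nat.cast_zero, mul_zero, mul_one, zero_smul, zero_add] at k1 k2
  have n1 : (l + 2 : ℝ) ≠ 0 := by positivity
  have n2 : ((l + 2) * (l + 1) / 2 : ℝ) ≠ 0 := by positivity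
  constructor
  · rw [← smul_add] at k1
    exact smul_right_injective _ n1 k1
  · refine smul_right_injective _ n2 (Eq.trans ?_ k2)
    module

/-- Behaviour of the Schwarzian `{A,t} = 2(P₂ - P₁² - P₁')` under the
right action of smooth invertible matrix curves and the left action of `GL(kn)`. -/
theorem stmt_2 (k n : ℕ) (hk : 2 ≤ k) (hn : 1 ≤ n)
    (A : ℝ → Matrix (Fin (k * n)) (Fin n) ℝ) (hA : IsFanning k n A)
    (P : ℕ → ℝ → Matrix (Fin n) (Fin n) ℝ) (hP : IsCoeffs k n A P) :
    (∀ X : ℝ → Matrix (Fin n) (Fin n) ℝ, MatSmooth X → (∀ t, IsUnit (X t)) →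
      IsFanning k n (fun t => A t * X t) ∧
      ∀ Q : ℕ → ℝ → Matrix (Fin n) (Fin n) ℝ,
        IsCoeffs k n (fun t => A t * X t) Q → ∀ t,
          (2 : ℝ) • (Q 2 t - Q 1 t * Q 1 t - mderiv (Q 1) t) =
            (X t)⁻¹ * ((2 : ℝ) • (P 2 t - P 1 t * P 1 t - mderiv (P 1) t)) * X t) ∧
    (∀ T : Matrix (Fin (k * n)) (Fin (k * n)) ℝ, IsUnit T →
      IsFanning k n (fun t => T * A t) ∧
      ∀ Q : ℕ → ℝ → Matrix (Fin n) (Fin n) ℝ,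
        IsCoeffs k n (fun t => T * A t) Q → ∀ t,
          (2 : ℝ) • (Q 2 t - Q 1 t * Q 1 t - mderiv (Q 1) t) =
            (2 : ℝ) • (P 2 t - P 1 t * P 1 t - mderiv (P 1) t)) := by
  refine ⟨fun X hX hu => ⟨hA.mul_right hX hu, fun Q hQ t => ?_⟩,
    fun T hT => ⟨hA.const_mul hT, fun Q hQ t => ?_⟩⟩
  · have hP1 : MatSmooth (P 1) := hP.1 1 (Finset.mem_Icc.2 ⟨le_rfl, by omega⟩)
    have hQ1 : MatSmooth (Q 1) := hQ.1 1 (Finset.mem_Icc.2 ⟨le_rfl, by omega⟩)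
    have tr := hP.mul_right_transform hk hA hX hQ
    have hd : mderiv (mderiv X) t = mderiv (P 1) t * X t + P 1 t * mderiv X t -
        (mderiv X t * Q 1 t + X t * mderiv (Q 1) t) := by
      rw [← mderiv_mul hP1 hX, ← mderiv_mul hX hQ1, ← funext fun s => (tr s).1,
        mderiv_add hX.mderiv (hX.mul hQ1), add_sub_cancel_right]
    obtain ⟨h1, h2⟩ := tr t
    have hdet := (Matrix.isUnit_iff_isUnit_det _).1 (hu t)
    have main : X t * (Q 2 t - Q 1 t * Q 1 t - mderiv (Q 1) t) =
        (P 2 t - P 1 t * P 1 t - mderiv (P 1) t) * X t := by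
      have hx : mderiv X t = P 1 t * X t - X t * Q 1 t := eq_sub_of_add_eq h1
      rw [hd, hx] at h2
      simp only [Matrix.mul_sub, Matrix.sub_mul, Matrix.mul_assoc] at h2 ⊢
      rw [← sub_eq_zero] at h2 ⊢
      rw [← h2]
      module
    rw [Matrix.mul_assoc, Matrix.smul_mul, ← main, Matrix.mul_smul,
      Matrix.nonsing_inv_mul_cancel_left _ _ hdet]
  · have hQ' := hQ.of_const_mul hA.1 hT
    rw [hP.unique hA hQ' le_rfl (by omega), hP.unique hA hQ' one_le_two hk]
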